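/- arXiv:2207.06483 — 4 statements merged into one kernel-verified Lean document; each statement's English description precedes it below -/
import Mathlib

section
/- Let X be a reflexive real Banach space. Let Φ : X → ℝ be a coercive, continuously Gâteaux differentiable and sequentially weakly lower semicontinuous functional whose Gâteaux derivative Φ' : X → X* admits a continuous inverse (i.e., there is a continuous map T : X* → X with T ∘ Φ' = id_X and Φ' ∘ T = id_{X*}). Let Ψ : X → ℝ be a continuously Gâteaux differentiable functional whose Gâteaux derivative Ψ' : X → X* is compact (it maps bounded subsets of X to relatively compact subsets of X*). Assume Φ(0) = Ψ(0) = 0, and that there exist r > 0 and x̄ ∈ X with r < Φ(x̄) such that: (a1) (sup_{x : Φ(x) ≤ r} Ψ(x))/r < Ψ(x̄)/Φ(x̄), and (a2) for each λ in the open interval Λ_r := ( Φ(x̄)/Ψ(x̄) , r / sup_{x : Φ(x) ≤ r} Ψ(x) ), the functional Φ − λΨ is coercive. Then for each λ ∈ Λ_r the functional Φ − λΨ has at least three distinct critical points in X, i.e., three distinct points u ∈ X with Φ'(u) − λΨ'(u) = 0 in X*. -/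
open Filter Topology

/-- Ekeland's variational principle on a closed subset of a complete metric space. -/
theorem ekeland_variational_principle {E : Type*} [MetricSpace E] [CompleteSpace E]
    {f : E → ℝ} (hf : LowerSemicontinuous f) {D : Set E} (hD : IsClosed D) {m : ℝ}
    (hm : ∀ x ∈ D, m ≤ f x) {ε : ℝ} (hε : 0 < ε) {x₀ : E} (hx₀ : x₀ ∈ D) :
    ∃ y ∈ D, f y ≤ f x₀ ∧ ∀ x ∈ D, f y ≤ f x + ε * dist x y := by
  set S : E → Set E := fun x => {y | y ∈ D ∧ f y + ε * dist y x ≤ f x} with hS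
  have hSclosed : ∀ x, IsClosed (S x) := fun x =>
    have hc : Continuous fun y => ε * dist y x := by fun_prop
    hD.inter ((hf.add hc.lowerSemicontinuous).isClosed_preimage (f x))
  have hStrans : ∀ x y z, y ∈ S x → z ∈ S y → z ∈ S x := by
    rintro x y z ⟨_, hy⟩ ⟨hz, hzy⟩
    exact ⟨hz, by nlinarith [dist_triangle z y x]⟩
  have hSself : ∀ x ∈ D, x ∈ S x := fun x hx => ⟨hx, by simp⟩
  have hbdd : ∀ x, BddBelow (f '' S x) := fun x => ⟨m, by
    rintro _ ⟨y, hy, rfl⟩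
    exact hm y hy.1⟩
  have step : ∀ (n : ℕ) (x : D), ∃ y : D, (y : E) ∈ S x ∧
      f y < sInf (f '' S x) + 1 / ((n : ℝ) + 1) := by
    intro n x
    obtain ⟨_, ⟨y, hy, rfl⟩, hlt⟩ := exists_lt_of_csInf_lt
      (⟨f x, x, hSself x x.2, rfl⟩ : (f '' S x).Nonempty)
      (lt_add_of_pos_right (sInf (f '' S x)) (Nat.one_div_pos_of_nat (n := n) (α := ℝ)))
    exact ⟨⟨y, hy.1⟩, hy, hlt⟩
  choose next hnext hnext_lt using step
  let u : ℕ → D := fun n => Nat.rec (motive := fun _ => D) ⟨x₀, hx₀⟩ (fun k x => next k x) n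
  have hu_succ : ∀ n, (u (n + 1)).1 ∈ S (u n).1 := fun n => hnext n (u n)
  have hu_lt : ∀ n, f (u (n + 1)) < sInf (f '' S (u n).1) + 1 / ((n : ℝ) + 1) :=
    fun n => hnext_lt n (u n)
  have hu_mem : ∀ n m, n ≤ m → (u m).1 ∈ S (u n).1 := by
    intro n m hnm
    induction m, hnm using Nat.le_induction with
    | base => exact hSself _ (u n).2
    | succ k _ ih => exact hStrans _ _ _ ih (hu_succ k)
  have hanti : Antitone fun n => f (u n) := antitone_nat_of_succ_le fun n => by
    have h := (hu_succ n).2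
    have := mul_nonneg hε.le (dist_nonneg (x := ((u (n + 1) : D) : E)) (y := u n))
    linarith
  have hlim := tendsto_atTop_ciInf hanti ⟨m, by
    rintro _ ⟨n, rfl⟩
    exact hm _ (u n).2⟩
  set L := ⨅ n, f (u n)
  have hL : ∀ n, L ≤ f (u n) := fun n => hanti.le_of_tendsto hlim n
  have hcauchy : CauchySeq fun n => ((u n : D) : E) := by
    refine cauchySeq_of_le_tendsto_0 (fun n => 2 * ((f (u n) - L) / ε)) ?_ ?_
    · intro i j N hi hj
      have hd : ∀ i, N ≤ i → dist ((u i : D) : E) (u N) ≤ (f (u N) - L) / ε := by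
        intro i hi
        rw [le_div_iff₀ hε]
        linarith [(hu_mem N i hi).2, hL i]
      linarith [dist_triangle_right ((u i : D) : E) (u j) (u N), hd i hi, hd j hj]
    · simpa using ((hlim.sub_const L).div_const ε).const_mul 2
  obtain ⟨y, hy⟩ := cauchySeq_tendsto_of_complete hcauchy
  have hyS : ∀ n, y ∈ S (u n).1 := fun n =>
    (hSclosed (u n)).mem_of_tendsto hy ((eventually_ge_atTop n).mono fun k hk => hu_mem n k hk)
  have hle : ∀ n, f y ≤ f (u n) := fun n => by
    have h := (hyS n).2
    have := mul_nonneg hε.le (dist_nonneg (x := y) (y := ((u n : D) : E)))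
    linarith
  refine ⟨y, (hyS 0).1, hle 0, fun x hx => ?_⟩
  by_contra! hlt
  have hxS : x ∈ S y := ⟨hx, hlt.le⟩
  have h1 : L ≤ f x := by
    have hlim' : Tendsto (fun n : ℕ => f (u (n + 1)) - 1 / ((n : ℝ) + 1)) atTop (𝓝 (L - 0)) :=
      ((tendsto_add_atTop_iff_nat 1).2 hlim).sub tendsto_one_div_add_atTop_nhds_zero_nat
    rw [sub_zero] at hlim'
    refine le_of_tendsto' hlim' fun n => ?_
    have := csInf_le (hbdd (u n)) ⟨x, hStrans _ _ _ (hyS n) hxS, rfl⟩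
    linarith [hu_lt n]
  have h2 : f y ≤ L := ge_of_tendsto' hlim hle
  have := mul_nonneg hε.le (dist_nonneg (x := x) (y := y))
  linarith

section GateauxC1

variable {X : Type*} [NormedAddCommGroup X] [NormedSpace ℝ X] {F : X → ℝ} {F' : X → (X →L[ℝ] ℝ)}

/-- `F` is Gâteaux differentiable with continuous derivative `F'`. -/
structure IsC1Gateaux (F : X → ℝ) (F' : X → (X →L[ℝ] ℝ)) : Prop where
  continuous_deriv : Continuous F'
  hasDerivAt : ∀ u v : X, HasDerivAt (fun t : ℝ => F (u + t • v)) (F' u v) 0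

/-- The Palais–Smale condition at all levels. -/
def PalaisSmale (F : X → ℝ) (F' : X → (X →L[ℝ] ℝ)) : Prop :=
  ∀ x : ℕ → X, (∃ M, ∀ n, |F (x n)| ≤ M) → Tendsto (fun n => F' (x n)) atTop (𝓝 0) →
    ∃ (u : X) (φ : ℕ → ℕ), StrictMono φ ∧ Tendsto (x ∘ φ) atTop (𝓝 u)

namespace IsC1Gateaux

theorem exists_mean_value (hF : IsC1Gateaux F F') (u v : X) :
    ∃ t ∈ Set.Ioo (0 : ℝ) 1, F (u + v) - F u = F' (u + t • v) v := by
  have hd : ∀ t : ℝ, HasDerivAt (fun t : ℝ => F (u + t • v)) (F' (u + t • v) v) t := by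
    intro t
    have h := hF.hasDerivAt (u + t • v) v
    rw [← sub_self t] at h
    have h' := h.comp_sub_const t t
    have e : (fun x : ℝ => F (u + t • v + (x - t) • v)) = fun x => F (u + x • v) := by
      funext x
      congr 1
      module
    rwa [e] at h'
  obtain ⟨t, ht, h⟩ := exists_hasDerivAt_eq_slope (fun t : ℝ => F (u + t • v))
    (fun t => F' (u + t • v) v) one_pos
    (fun t _ => (hd t).continuousAt.continuousWithinAt) fun t _ => hd t
  exact ⟨t, ht, by simpa using h.symm⟩

theorem continuous (hF : IsC1Gateaux F F') : Continuous F := by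
  rw [continuous_iff_continuousAt]
  intro x
  obtain ⟨δ, hδ, hball⟩ := Metric.continuousAt_iff.1
    (hF.continuous_deriv.continuousAt (x := x)) 1 one_pos
  refine continuousAt_of_locally_lipschitz hδ (‖F' x‖ + 1) fun y hy => ?_
  obtain ⟨t, ht, h⟩ := hF.exists_mean_value x (y - x)
  rw [add_sub_cancel] at h
  rw [Real.dist_eq, h, dist_eq_norm]
  have hmem : dist (x + t • (y - x)) x < δ := by
    rw [dist_eq_norm, add_sub_cancel_left, norm_smul, Real.norm_of_nonneg ht.1.le]
    rw [dist_eq_norm] at hy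
    nlinarith [norm_nonneg (y - x), ht.2]
  have h1 := hball hmem
  rw [dist_eq_norm] at h1
  refine ((F' (x + t • (y - x))).le_opNorm _).trans ?_
  gcongr
  linarith [norm_le_norm_add_norm_sub' (F' (x + t • (y - x))) (F' x)]

theorem sub_smul {G : X → ℝ} {G' : X → (X →L[ℝ] ℝ)} (hF : IsC1Gateaux F F')
    (hG : IsC1Gateaux G G') (c : ℝ) :
    IsC1Gateaux (fun x => F x - c * G x) (fun x => F' x - c • G' x) where
  hasDerivAt u v := by
    simpa using (hF.hasDerivAt u v).fun_sub ((hG.hasDerivAt u v).const_mul c)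
  continuous_deriv := hF.continuous_deriv.sub (hG.continuous_deriv.const_smul c)

/-- A point at which the slope of `F` is at most `ε` has derivative of norm at most `ε`. -/
theorem norm_deriv_le (hF : IsC1Gateaux F F') {y : X} {ε : ℝ} (hε : 0 ≤ ε)
    (h : ∀ᶠ x in 𝓝 y, F y ≤ F x + ε * dist x y) : ‖F' y‖ ≤ ε := by
  have key : ∀ v : X, -(ε * ‖v‖) ≤ F' y v := by
    intro v
    have hcont : Tendsto (fun t : ℝ => y + t • v) (𝓝[>] 0) (𝓝 y) := by
      have : Continuous fun t : ℝ => y + t • v := by fun_prop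
      simpa using (this.tendsto 0).mono_left nhdsWithin_le_nhds
    have hslope := (hF.hasDerivAt y v).tendsto_slope_zero_right
    refine ge_of_tendsto hslope ?_
    filter_upwards [hcont.eventually h, self_mem_nhdsWithin] with t ht htpos
    have htpos : 0 < t := htpos
    rw [dist_eq_norm, add_sub_cancel_left, norm_smul, Real.norm_of_nonneg htpos.le] at ht
    simp only [zero_add, zero_smul, add_zero, smul_eq_mul]
    rw [inv_mul_eq_div, le_div_iff₀ htpos]
    nlinarith
  refine ContinuousLinearMap.opNorm_le_bound _ hε fun v => ?_
  rw [Real.norm_eq_abs, abs_le]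
  refine ⟨key v, ?_⟩
  have := key (-v)
  rw [norm_neg, map_neg] at this
  linarith

/-- A functional satisfying the Palais–Smale condition, bounded below on a closed set `D`,
attains its infimum over `D` at a critical point in the open part `U` of `D`, provided that it is
large on the rest of `D`. -/
theorem exists_critical_of_lt [CompleteSpace X] (hF : IsC1Gateaux F F') (hPS : PalaisSmale F F')
    {D U : Set X} (hD : IsClosed D) (hU : IsOpen U) (hUD : U ⊆ D) {m β : ℝ}
    (hm : ∀ x ∈ D, m ≤ F x) (hβ : ∀ x ∈ D, x ∉ U → β ≤ F x) {x₀ : X} (hx₀ : x₀ ∈ D)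
    (hlt : F x₀ < β) : ∃ u ∈ U, F' u = 0 ∧ F u ≤ F x₀ := by
  have hek : ∀ n : ℕ, ∃ y ∈ D, F y ≤ F x₀ ∧ ∀ x ∈ D, F y ≤ F x + 1 / ((n : ℝ) + 1) * dist x y :=
    fun n => ekeland_variational_principle hF.continuous.lowerSemicontinuous hD hm
      Nat.one_div_pos_of_nat hx₀
  choose y hyD hyle hy using hek
  have hyU : ∀ n, y n ∈ U := fun n => by
    by_contra h
    linarith [hβ _ (hyD n) h, hyle n]
  have hderiv : ∀ n, ‖F' (y n)‖ ≤ 1 / ((n : ℝ) + 1) := fun n =>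
    hF.norm_deriv_le Nat.one_div_pos_of_nat.le <|
      Filter.mem_of_superset (hU.mem_nhds (hyU n)) fun x hx => hy n x (hUD hx)
  have hzero : Tendsto (fun n => F' (y n)) atTop (𝓝 0) :=
    squeeze_zero_norm hderiv tendsto_one_div_add_atTop_nhds_zero_nat
  obtain ⟨u, φ, hφ, hu⟩ := hPS y ⟨max |m| |F x₀|, fun n =>
    abs_le_max_abs_abs (hm _ (hyD n)) (hyle n)⟩ hzero
  have huD : u ∈ D := hD.mem_of_tendsto hu (Eventually.of_forall fun n => hyD _)
  have hule : F u ≤ F x₀ :=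
    le_of_tendsto' ((hF.continuous.tendsto u).comp hu) fun n => hyle _
  refine ⟨u, ?_, ?_, hule⟩
  · by_contra h
    linarith [hβ u huD h]
  · exact tendsto_nhds_unique ((hF.continuous_deriv.tendsto u).comp hu)
      (hzero.comp hφ.tendsto_atTop)

/-- The maximum of `F` along the path `γ`. -/
noncomputable def maxAlong (F : X → ℝ) (γ : C(unitInterval, X)) : ℝ := ⨆ t, F (γ t)

theorem bddAbove_range_comp (hF : IsC1Gateaux F F') (γ : C(unitInterval, X)) :
    BddAbove (Set.range fun t => F (γ t)) :=
  (isCompact_range (hF.continuous.comp γ.continuous)).bddAbove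

theorem le_maxAlong (hF : IsC1Gateaux F F') (γ : C(unitInterval, X)) (t : unitInterval) :
    F (γ t) ≤ maxAlong F γ :=
  le_ciSup (hF.bddAbove_range_comp γ) t

theorem exists_eq_maxAlong (hF : IsC1Gateaux F F') (γ : C(unitInterval, X)) :
    ∃ t, F (γ t) = maxAlong F γ := by
  obtain ⟨t, -, ht⟩ := isCompact_univ.exists_isMaxOn Set.univ_nonempty
    (hF.continuous.comp γ.continuous).continuousOn
  exact ⟨t, (hF.le_maxAlong γ t).antisymm (ciSup_le fun s => ht (Set.mem_univ s))⟩

theorem lowerSemicontinuous_maxAlong (hF : IsC1Gateaux F F') :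
    LowerSemicontinuous (maxAlong F) :=
  lowerSemicontinuous_ciSup hF.bddAbove_range_comp fun t =>
    (hF.continuous.comp (continuous_eval_const t)).lowerSemicontinuous

/-- A path that almost minimizes the maximum of `F` among paths with the same end points passes
through an almost critical point at its maximal level. -/
theorem exists_almost_critical (hF : IsC1Gateaux F F') {γ : C(unitInterval, X)} {ε : ℝ}
    (hε : 0 < ε) (h0 : F (γ 0) < maxAlong F γ) (h1 : F (γ 1) < maxAlong F γ)
    (hγ : ∀ η : C(unitInterval, X), η 0 = γ 0 → η 1 = γ 1 →
      maxAlong F γ ≤ maxAlong F η + ε * dist η γ) :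
    ∃ t, F (γ t) = maxAlong F γ ∧ ‖F' (γ t)‖ ≤ 2 * ε := by
  by_contra! hcon
  have hclosed : IsClosed {t | F (γ t) = maxAlong F γ} :=
    isClosed_eq (hF.continuous.comp γ.continuous) continuous_const
  obtain ⟨v, hv⟩ : ∃ v : C(unitInterval, X), ∀ t, v t ∈ {w : X | ‖w‖ ≤ 1 ∧
      (F (γ t) = maxAlong F γ → F' (γ t) w < -(2 * ε)) ∧
      (F (γ t) ≠ maxAlong F γ → t = 0 ∨ t = 1 → w = 0)} := by
    refine exists_continuous_forall_mem_convex_of_local_const (fun t => ?_) fun t => ?_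
    · have e : {w : X | ‖w‖ ≤ 1 ∧ (F (γ t) = maxAlong F γ → F' (γ t) w < -(2 * ε)) ∧
          (F (γ t) ≠ maxAlong F γ → t = 0 ∨ t = 1 → w = 0)} =
          Metric.closedBall 0 1 ∩
          ({w | F (γ t) = maxAlong F γ → F' (γ t) w < -(2 * ε)} ∩
          {w | F (γ t) ≠ maxAlong F γ → t = 0 ∨ t = 1 → w = 0}) := by
        ext w
        simp
      rw [e]
      refine (convex_closedBall 0 1).inter (.inter ?_ ?_)
      · by_cases h : F (γ t) = maxAlong F γ
        · simpa [h] using convex_halfSpace_lt (F' (γ t)).isLinear (-(2 * ε))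
        · simp [h, convex_univ]
      · by_cases h : F (γ t) ≠ maxAlong F γ ∧ (t = 0 ∨ t = 1)
        · simp [h]
        · have : {w : X | F (γ t) ≠ maxAlong F γ → t = 0 ∨ t = 1 → w = 0} = Set.univ := by
            ext w
            simp only [Set.mem_ofPred_eq, Set.mem_univ, iff_true]
            exact fun a b => (h ⟨a, b⟩).elim
          rw [this]
          exact convex_univ
    · by_cases ht : F (γ t) = maxAlong F γ
      · obtain ⟨w, hw, hlt⟩ : ∃ w, ‖w‖ ≤ 1 ∧ F' (γ t) w < -(2 * ε) := by
          obtain ⟨w, hw, hlt⟩ := (F' (γ t)).exists_lt_apply_of_lt_opNorm (hcon t ht)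
          rw [Real.norm_eq_abs, lt_abs] at hlt
          rcases hlt with hlt | hlt
          · exact ⟨-w, by simpa using hw.le, by rw [map_neg]; linarith⟩
          · exact ⟨w, hw.le, by linarith⟩
        refine ⟨w, ?_⟩
        have hc : Continuous fun s => F' (γ s) w :=
          (hF.continuous_deriv.comp γ.continuous).clm_apply continuous_const
        have hne0 : ∀ᶠ s in 𝓝 t, s ≠ 0 := isOpen_ne.mem_nhds (by rintro rfl; exact h0.ne ht)
        have hne1 : ∀ᶠ s in 𝓝 t, s ≠ 1 := isOpen_ne.mem_nhds (by rintro rfl; exact h1.ne ht)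
        filter_upwards [hc.continuousAt.eventually_lt continuousAt_const hlt, hne0, hne1]
          with s hs hs0 hs1
        exact ⟨hw, fun _ => hs, fun _ h => (h.elim hs0 hs1).elim⟩
      · refine ⟨0, ?_⟩
        filter_upwards [hclosed.isOpen_compl.mem_nhds ht] with s hs
        exact ⟨by simp, fun h => (hs h).elim, fun _ _ => rfl⟩
  have hv0 : v 0 = 0 := (hv 0).2.2 h0.ne (.inl rfl)
  have hv1 : v 1 = 0 := (hv 1).2.2 h1.ne (.inr rfl)
  have hvle : ‖v‖ ≤ 1 := (ContinuousMap.norm_le _ zero_le_one).2 fun t => (hv t).1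
  set h : ℕ → ℝ := fun n => 1 / ((n : ℝ) + 1) with hh
  have hpos : ∀ n, 0 < h n := fun n => Nat.one_div_pos_of_nat
  have hlim : Tendsto h atTop (𝓝 0) := tendsto_one_div_add_atTop_nhds_zero_nat
  have hbase : ∀ n, maxAlong F γ ≤ maxAlong F (γ + h n • v) + ε * h n := by
    intro n
    refine (hγ (γ + h n • v) (by simp [hv0]) (by simp [hv1])).trans ?_
    rw [dist_eq_norm, add_sub_cancel_left, norm_smul, Real.norm_of_nonneg (hpos n).le]
    nlinarith [mul_nonneg hε.le (hpos n).le]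
  choose τ hτ using fun n => hF.exists_eq_maxAlong (γ + h n • v)
  choose θ hθ hmean using fun n => hF.exists_mean_value (γ (τ n)) (h n • v (τ n))
  have hτ' : ∀ n, F (γ (τ n) + h n • v (τ n)) = maxAlong F (γ + h n • v) := fun n => by
    simpa using hτ n
  have hslope : ∀ n, -ε ≤ F' (γ (τ n) + θ n • h n • v (τ n)) (v (τ n)) := by
    intro n
    have hm := hmean n
    rw [hτ', map_smul, smul_eq_mul] at hm
    have := hF.le_maxAlong γ (τ n)
    have := hbase n
    by_contra! hlt
    nlinarith [mul_lt_mul_of_pos_left hlt (hpos n)]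
  obtain ⟨t, φ, hφ, ht⟩ := CompactSpace.tendsto_subseq τ
  have hh' : Tendsto (fun n => h (φ n)) atTop (𝓝 0) := hlim.comp hφ.tendsto_atTop
  have hγt : Tendsto (fun n => γ (τ (φ n))) atTop (𝓝 (γ t)) := (γ.continuous.tendsto t).comp ht
  have hvt : Tendsto (fun n => v (τ (φ n))) atTop (𝓝 (v t)) := (v.continuous.tendsto t).comp ht
  have hθh : Tendsto (fun n => θ (φ n) * h (φ n)) atTop (𝓝 0) :=
    squeeze_zero (fun n => mul_nonneg (hθ _).1.le (hpos _).le)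
      (fun n => mul_le_of_le_one_left (hpos _).le (hθ _).2.le) hh'
  have hmax : F (γ t) = maxAlong F γ := by
    refine (hF.le_maxAlong γ t).antisymm ?_
    have hl : Tendsto (fun n => F (γ (τ (φ n)) + h (φ n) • v (τ (φ n))) + ε * h (φ n)) atTop
        (𝓝 (F (γ t + (0 : ℝ) • v t) + ε * 0)) :=
      ((hF.continuous.tendsto _).comp (hγt.add (hh'.smul hvt))).add (hh'.const_mul ε)
    rw [zero_smul, add_zero, mul_zero, add_zero] at hl
    refine ge_of_tendsto' hl fun n => ?_
    rw [hτ']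
    exact hbase _
  have hl : Tendsto (fun n => F' (γ (τ (φ n)) + (θ (φ n) * h (φ n)) • v (τ (φ n))) (v (τ (φ n))))
      atTop (𝓝 (F' (γ t + (0 : ℝ) • v t) (v t))) :=
    (isBoundedBilinearMap_apply.continuous.tendsto (F' (γ t + (0 : ℝ) • v t), v t)).comp
      (((hF.continuous_deriv.tendsto _).comp (hγt.add (hθh.smul hvt))).prodMk_nhds hvt)
  rw [zero_smul, add_zero] at hl
  have := ge_of_tendsto' hl fun n => by simpa [mul_smul] using hslope (φ n)
  linarith [(hv t).2.1 hmax]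

/-- The mountain pass theorem: if `F` is at least `β` on a level set of a continuous function
separating two points at which `F` is less than `β`, then `F` has a critical point of value at
least `β`. -/
theorem mountain_pass [CompleteSpace X] (hF : IsC1Gateaux F F') (hPS : PalaisSmale F F')
    {g : X → ℝ} (hg : Continuous g) {ρ β : ℝ} (hβ : ∀ x, g x = ρ → β ≤ F x) {e₀ e₁ : X}
    (hg₀ : g e₀ ≤ ρ) (hg₁ : ρ ≤ g e₁) (h₀ : F e₀ < β) (h₁ : F e₁ < β) :
    ∃ u, F' u = 0 ∧ β ≤ F u := by
  set D : Set C(unitInterval, X) := {γ | γ 0 = e₀ ∧ γ 1 = e₁} with hDdef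
  have hD : IsClosed D :=
    (isClosed_eq (continuous_eval_const 0) continuous_const).inter
      (isClosed_eq (continuous_eval_const 1) continuous_const)
  have hmax : ∀ γ ∈ D, β ≤ maxAlong F γ := by
    rintro γ ⟨hγ0, hγ1⟩
    obtain ⟨t, ht⟩ : ρ ∈ Set.range fun t => g (γ t) :=
      mem_range_of_exists_le_of_exists_ge (hg.comp γ.continuous) ⟨0, by simpa [hγ0] using hg₀⟩
        ⟨1, by simpa [hγ1] using hg₁⟩
    exact (hβ _ ht).trans (hF.le_maxAlong γ t)
  obtain ⟨γ₀, hγ₀⟩ : D.Nonempty :=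
    ⟨⟨fun t => e₀ + (t : ℝ) • (e₁ - e₀), by fun_prop⟩, by simp [hDdef]⟩
  have hek : ∀ n : ℕ, ∃ x, β ≤ F x ∧ F x ≤ maxAlong F γ₀ ∧ ‖F' x‖ ≤ 2 * (1 / ((n : ℝ) + 1)) := by
    intro n
    obtain ⟨γ, hγD, hle, hγ⟩ := ekeland_variational_principle hF.lowerSemicontinuous_maxAlong hD
      hmax (Nat.one_div_pos_of_nat (n := n) (α := ℝ)) hγ₀
    obtain ⟨t, ht, hder⟩ := hF.exists_almost_critical Nat.one_div_pos_of_nat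
      (by rw [hγD.1]; exact h₀.trans_le (hmax γ hγD))
      (by rw [hγD.2]; exact h₁.trans_le (hmax γ hγD))
      fun η hη0 hη1 => hγ η ⟨hη0.trans hγD.1, hη1.trans hγD.2⟩
    exact ⟨γ t, ht ▸ hmax γ hγD, ht ▸ hle, hder⟩
  choose x hxβ hxle hx using hek
  have hzero : Tendsto (fun n => F' (x n)) atTop (𝓝 0) :=
    squeeze_zero_norm hx (by simpa using tendsto_one_div_add_atTop_nhds_zero_nat.const_mul (2 : ℝ))
  obtain ⟨u, φ, hφ, hu⟩ := hPS x ⟨max |β| |maxAlong F γ₀|, fun n =>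
    abs_le_max_abs_abs (hxβ n) (hxle n)⟩ hzero
  exact ⟨u, tendsto_nhds_unique ((hF.continuous_deriv.tendsto u).comp hu)
    (hzero.comp hφ.tendsto_atTop),
    ge_of_tendsto' ((hF.continuous.tendsto u).comp hu) fun n => hxβ _⟩

end IsC1Gateaux

/-- The identity up to `C`, bent smoothly into a constant between `C` and `C + 1`. -/
noncomputable def softCap (C τ : ℝ) : ℝ :=
  τ - max (τ - C) 0 ^ 2 / 2 + max (τ - (C + 1)) 0 ^ 2 / 2

/-- The derivative of `softCap`. -/
noncomputable def softCapDeriv (C τ : ℝ) : ℝ :=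
  1 - max (τ - C) 0 + max (τ - (C + 1)) 0

theorem hasDerivAt_max_zero_sq (x : ℝ) :
    HasDerivAt (fun x : ℝ => max x 0 ^ 2 / 2) (max x 0) x := by
  rcases lt_trichotomy x 0 with hx | rfl | hx
  · rw [max_eq_right hx.le]
    refine (hasDerivAt_const x (0 : ℝ)).congr_of_eventuallyEq ?_
    filter_upwards [gt_mem_nhds hx] with y hy
    simp [max_eq_right hy.le]
  · rw [max_self, hasDerivAt_iff_isLittleO]
    have h : (fun x : ℝ => max x 0 ^ 2 / 2) =O[𝓝 0] fun x : ℝ => x ^ 2 := by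
      refine Asymptotics.IsBigO.of_bound 1 (Eventually.of_forall fun y => ?_)
      rw [one_mul, Real.norm_of_nonneg (by positivity), Real.norm_of_nonneg (by positivity)]
      rcases max_cases y 0 with h | h <;> rw [h.1] <;> nlinarith [sq_nonneg y]
    simpa using h.trans_isLittleO (Asymptotics.isLittleO_pow_id one_lt_two)
  · rw [max_eq_left hx.le]
    have h : HasDerivAt (fun y : ℝ => y ^ 2 / 2) x x := by
      simpa using (hasDerivAt_pow 2 x).div_const 2
    refine h.congr_of_eventuallyEq ?_
    filter_upwards [lt_mem_nhds hx] with y hy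
    simp [max_eq_left hy.le]

theorem hasDerivAt_softCap (C τ : ℝ) : HasDerivAt (softCap C) (softCapDeriv C τ) τ :=
  ((hasDerivAt_id τ).fun_sub ((hasDerivAt_max_zero_sq (τ - C)).comp_sub_const τ C)).fun_add
    ((hasDerivAt_max_zero_sq (τ - (C + 1))).comp_sub_const τ (C + 1))

theorem continuous_softCapDeriv (C : ℝ) : Continuous (softCapDeriv C) := by
  unfold softCapDeriv
  fun_prop

theorem softCap_of_le {C τ : ℝ} (h : τ ≤ C) : softCap C τ = τ := by
  simp [softCap, max_eq_right (sub_nonpos.2 h), max_eq_right (by linarith : τ - (C + 1) ≤ 0)]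

theorem softCap_le (C τ : ℝ) : softCap C τ ≤ C + 1 := by
  unfold softCap
  rcases max_cases (τ - C) 0 with h | h <;> rcases max_cases (τ - (C + 1)) 0 with h' | h' <;>
    rw [h.1, h'.1] <;> nlinarith

theorem softCapDeriv_of_le {C τ : ℝ} (h : τ ≤ C) : softCapDeriv C τ = 1 := by
  simp [softCapDeriv, max_eq_right (sub_nonpos.2 h), max_eq_right (by linarith : τ - (C + 1) ≤ 0)]

theorem softCapDeriv_mem_Icc (C τ : ℝ) : softCapDeriv C τ ∈ Set.Icc (0 : ℝ) 1 := by
  unfold softCapDeriv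
  constructor <;>
  rcases max_cases (τ - C) 0 with h | h <;> rcases max_cases (τ - (C + 1)) 0 with h' | h' <;>
    rw [h.1, h'.1] <;> linarith

theorem isC1Gateaux_softCap (C : ℝ) (ℓ : X →L[ℝ] ℝ) :
    IsC1Gateaux (fun x => softCap C (ℓ x)) (fun x => softCapDeriv C (ℓ x) • ℓ) where
  hasDerivAt u v := by
    have h : HasDerivAt (fun t : ℝ => ℓ (u + t • v)) (ℓ v) 0 := by
      simpa using ((hasDerivAt_id (0 : ℝ)).mul_const (ℓ v)).const_add (ℓ u)
    have h' : HasDerivAt (softCap C) (softCapDeriv C (ℓ u)) (ℓ (u + (0 : ℝ) • v)) := by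
      simpa using hasDerivAt_softCap C (ℓ u)
    simpa [Function.comp_def] using h'.comp (0 : ℝ) h
  continuous_deriv := ((continuous_softCapDeriv C).comp ℓ.continuous).smul continuous_const

/-- The Palais–Smale condition holds when the derivative is the difference of a map with a
continuous left inverse and a map which is relatively compact along Palais–Smale sequences. -/
theorem palaisSmale_of_leftInverse {A K : X → (X →L[ℝ] ℝ)} {T : (X →L[ℝ] ℝ) → X}
    (hT : Continuous T) (hTA : ∀ x, T (A x) = x)
    (hK : ∀ x : ℕ → X, (∃ M, ∀ n, |F (x n)| ≤ M) → ∃ C, IsCompact C ∧ ∀ n, K (x n) ∈ C) :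
    PalaisSmale F (fun x => A x - K x) := by
  intro x hx hzero
  obtain ⟨C, hC, hxC⟩ := hK x hx
  obtain ⟨k, -, φ, hφ, hk⟩ := hC.tendsto_subseq hxC
  refine ⟨T k, φ, hφ, ?_⟩
  have h : Tendsto (fun n => A (x (φ n))) atTop (𝓝 k) := by
    simpa using (hzero.comp hφ.tendsto_atTop).add hk
  simpa [Function.comp_def, hTA] using (hT.tendsto k).comp h

/-- A coercive `C¹` functional whose derivative has a continuous left inverse is bounded below. -/
theorem IsC1Gateaux.exists_lower_bound [CompleteSpace X] (hF : IsC1Gateaux F F')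
    (hcoer : ∀ M : ℝ, ∃ R : ℝ, ∀ x : X, R ≤ ‖x‖ → M ≤ F x) {T : (X →L[ℝ] ℝ) → X}
    (hT : Continuous T) (hTF : ∀ x, T (F' x) = x) : ∃ m, ∀ x, m ≤ F x := by
  by_contra! hcon
  rcases subsingleton_or_nontrivial X with hX | hX
  · obtain ⟨x, hx⟩ := hcon (F 0)
    exact hx.ne (congrArg F (Subsingleton.elim x 0))
  obtain ⟨v, hv⟩ := exists_ne (0 : X)
  obtain ⟨ℓ, hℓ, hℓv⟩ := exists_dual_vector ℝ v (norm_ne_zero_iff.2 hv)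
  have hℓle : ∀ x, |ℓ x| ≤ ‖x‖ := fun x => by simpa [hℓ] using ℓ.le_opNorm x
  obtain ⟨R, hR⟩ := hcoer 0
  obtain ⟨x₀, hx₀⟩ : ∃ x₀, ℓ x₀ = R + 1 := by
    refine ⟨((R + 1) / ‖v‖) • v, ?_⟩
    rw [map_smul, hℓv]
    simp [hv]
  have hpos : ∀ x, R ≤ ℓ x → 0 ≤ F x := fun x hx =>
    hR x (hx.trans ((le_abs_self _).trans (hℓle x)))
  set S := F x₀ + 1 with hS
  have hS0 : 0 < S := by linarith [hpos x₀ (by linarith)]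
  have hcomp : IsCompact ((fun t : ℝ => ℓ (T (t • ℓ))) '' Set.Icc 0 S) :=
    isCompact_Icc.image (by fun_prop)
  obtain ⟨B, hB⟩ := hcomp.bddAbove
  set C := max B (R + 1)
  have hG := hF.sub_smul (isC1Gateaux_softCap C ℓ) S
  have hcoef : ∀ x, S * softCapDeriv C (ℓ x) ∈ Set.Icc 0 S := fun x =>
    ⟨mul_nonneg hS0.le (softCapDeriv_mem_Icc C _).1,
      mul_le_of_le_one_right hS0.le (softCapDeriv_mem_Icc C _).2⟩
  have hPS : PalaisSmale (fun x => F x - S * softCap C (ℓ x))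
      (fun x => F' x - S • softCapDeriv C (ℓ x) • ℓ) := by
    refine palaisSmale_of_leftInverse hT hTF fun x _ =>
      ⟨(fun t : ℝ => t • ℓ) '' Set.Icc 0 S, isCompact_Icc.image (by fun_prop), fun n =>
        ⟨_, hcoef (x n), mul_smul _ _ _⟩⟩
  have huniq : ∀ x, F' x - S • softCapDeriv C (ℓ x) • ℓ = 0 → x = T (S • ℓ) := by
    intro x hx
    rw [sub_eq_zero, ← mul_smul] at hx
    have hxT := hTF x
    rw [hx] at hxT
    have hle : ℓ x ≤ C := by
      refine le_trans ?_ (le_max_left _ _)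
      conv_lhs => rw [← hxT]
      exact hB ⟨_, hcoef x, rfl⟩
    rw [softCapDeriv_of_le hle, mul_one] at hxT
    exact hxT.symm
  have hface : ∀ x, ℓ x = R → -(S * R) ≤ F x - S * softCap C (ℓ x) := by
    intro x hx
    rw [softCap_of_le (by rw [hx]; exact (by linarith : R ≤ R + 1).trans (le_max_right _ _)), hx]
    linarith [hpos x hx.ge]
  have hx₀lt : F x₀ - S * softCap C (ℓ x₀) < -(S * R) := by
    rw [softCap_of_le (by rw [hx₀]; exact le_max_right _ _), hx₀]
    linarith
  obtain ⟨z, hzR, hz, hzle⟩ := hG.exists_critical_of_lt hPS (D := {x | R ≤ ℓ x})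
    (U := {x | R < ℓ x}) (m := -(S * (C + 1))) (isClosed_le continuous_const ℓ.continuous)
    (isOpen_lt continuous_const ℓ.continuous) (fun x (hx : R < ℓ x) => hx.le)
    (fun x hx => by
      have := mul_le_mul_of_nonneg_left (softCap_le C (ℓ x)) hS0.le
      linarith [hpos x hx])
    (fun x hx hx' => hface x (le_antisymm (not_lt.1 hx') hx))
    (x₀ := x₀) (by simp [hx₀]) hx₀lt
  obtain ⟨w, hw⟩ := hcon (min 0 (-(S * R) - S * R))
  have hwR : ‖w‖ < R := by
    by_contra! h
    linarith [hR w h, hw.trans_le (min_le_left _ _)]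
  have hwℓ := abs_le.1 (hℓle w)
  have hwlt : F w - S * softCap C (ℓ w) < -(S * R) := by
    rw [softCap_of_le (by
      refine le_trans ?_ (le_max_right _ _)
      linarith)]
    nlinarith [hw.trans_le (min_le_right _ _)]
  obtain ⟨y, hy, hyle⟩ := hG.mountain_pass hPS ℓ.continuous hface (e₀ := w) (e₁ := z)
    (by linarith) (le_of_lt hzR) hwlt (hzle.trans_lt hx₀lt)
  rw [huniq y hy, ← huniq z hz] at hyle
  linarith

/-- A `C¹` functional with derivative bounded on bounded sets is bounded on bounded sets. -/
theorem IsC1Gateaux.exists_abs_le_of_norm_le (hF : IsC1Gateaux F F')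
    (hF' : ∀ s : Set X, Bornology.IsBounded s → Bornology.IsBounded (F' '' s)) (R : ℝ) :
    ∃ C, ∀ x, ‖x‖ ≤ R → |F x| ≤ C := by
  obtain ⟨K, hK⟩ := (hF' _ (Metric.isBounded_closedBall (x := (0 : X)) (r := R))).exists_norm_le
  refine ⟨|F 0| + K * R, fun x hx => ?_⟩
  obtain ⟨t, ht, h⟩ := hF.exists_mean_value 0 x
  rw [zero_add, zero_add] at h
  have htx : ‖t • x‖ ≤ R := by
    rw [norm_smul, Real.norm_of_nonneg ht.1.le]
    exact (mul_le_of_le_one_left (norm_nonneg x) ht.2.le).trans hx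
  have hKt : ‖F' (t • x)‖ ≤ K := hK _ ⟨_, by simpa using htx, rfl⟩
  have h1 : |F x - F 0| ≤ K * R := by
    rw [h, ← Real.norm_eq_abs]
    exact ((F' (t • x)).le_opNorm x).trans
      (mul_le_mul hKt hx (norm_nonneg x) ((norm_nonneg _).trans hKt))
  linarith [abs_sub_abs_le_abs_sub (F x) (F 0)]

end GateauxC1

/-- Bonanno–Marano three critical points theorem. -/
theorem bonanno_marano_three_critical_points
    (X : Type*) [NormedAddCommGroup X] [NormedSpace ℝ X] [CompleteSpace X]
    -- X is reflexive: the canonical inclusion into the double dual is surjective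
    (hrefl : Function.Surjective (NormedSpace.inclusionInDoubleDual ℝ X))
    (Φ Ψ : X → ℝ) (Φ' Ψ' : X → (X →L[ℝ] ℝ))
    -- Φ is Gâteaux differentiable with derivative Φ'
    (hΦdiff : ∀ u v : X, HasDerivAt (fun t : ℝ => Φ (u + t • v)) (Φ' u v) 0)
    -- continuously so
    (hΦ'cont : Continuous Φ')
    -- Φ is coercive
    (hΦcoercive : ∀ M : ℝ, ∃ R : ℝ, ∀ x : X, R ≤ ‖x‖ → M ≤ Φ x)
    -- Φ is sequentially weakly lower semicontinuous
    (hΦswlsc : ∀ (x : ℕ → X) (x₀ : X),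
      (∀ ℓ : X →L[ℝ] ℝ, Tendsto (fun n => ℓ (x n)) atTop (𝓝 (ℓ x₀))) →
      Φ x₀ ≤ atTop.liminf (fun n => Φ (x n)))
    -- Φ' admits a continuous inverse T on X*
    (T : (X →L[ℝ] ℝ) → X) (hTcont : Continuous T)
    (hTleft : ∀ x : X, T (Φ' x) = x) (hTright : ∀ ℓ : X →L[ℝ] ℝ, Φ' (T ℓ) = ℓ)
    -- Ψ is continuously Gâteaux differentiable with derivative Ψ'
    (hΨdiff : ∀ u v : X, HasDerivAt (fun t : ℝ => Ψ (u + t • v)) (Ψ' u v) 0)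
    (hΨ'cont : Continuous Ψ')
    -- Ψ' is compact: it maps bounded sets to relatively compact sets
    (hΨ'compact : ∀ s : Set X, Bornology.IsBounded s → IsCompact (closure (Ψ' '' s)))
    (hΦ0 : Φ 0 = 0) (hΨ0 : Ψ 0 = 0)
    (r : ℝ) (hr : 0 < r) (xbar : X) (hrx : r < Φ xbar)
    -- (a1)
    (ha1 : sSup (Ψ '' {x : X | Φ x ≤ r}) / r < Ψ xbar / Φ xbar)
    -- (a2) : for each λ ∈ Λ_r, Φ - λΨ is coercive
    (ha2 : ∀ lam ∈ Set.Ioo (Φ xbar / Ψ xbar) (r / sSup (Ψ '' {x : X | Φ x ≤ r})),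
      ∀ M : ℝ, ∃ R : ℝ, ∀ x : X, R ≤ ‖x‖ → M ≤ Φ x - lam * Ψ x) :
    -- conclusion: three distinct critical points of Φ - λΨ
    ∀ lam ∈ Set.Ioo (Φ xbar / Ψ xbar) (r / sSup (Ψ '' {x : X | Φ x ≤ r})),
      ∃ u v w : X, u ≠ v ∧ u ≠ w ∧ v ≠ w ∧
        Φ' u = lam • Ψ' u ∧ Φ' v = lam • Ψ' v ∧ Φ' w = lam • Ψ' w := by
  intro lam hlam
  have hΦ : IsC1Gateaux Φ Φ' := ⟨hΦ'cont, hΦdiff⟩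
  have hΨ : IsC1Gateaux Ψ Ψ' := ⟨hΨ'cont, hΨdiff⟩
  have hI := hΦ.sub_smul hΨ lam
  have hcoer := ha2 lam hlam
  have hΨbdd := hΨ.exists_abs_le_of_norm_le fun s hs =>
    (hΨ'compact s hs).isBounded.subset subset_closure
  obtain ⟨R, hR⟩ := hΦcoercive (r + 1)
  obtain ⟨C, hRC⟩ := hΨbdd R
  have hC : ∀ x, Φ x ≤ r → |Ψ x| ≤ C := fun x hx => hRC x <| by
    by_contra! h
    linarith [hR x h.le]
  set s := sSup (Ψ '' {x : X | Φ x ≤ r})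
  have hsle : ∀ x, Φ x ≤ r → Ψ x ≤ s := fun x hx =>
    le_csSup ⟨C, by rintro _ ⟨y, hy, rfl⟩; exact (le_abs_self _).trans (hC y hy)⟩ ⟨x, hx, rfl⟩
  have hs0 : 0 ≤ s := hΨ0 ▸ hsle 0 (by rw [hΦ0]; exact hr.le)
  have hΦxbar : 0 < Φ xbar := hr.trans hrx
  have hΨxbar : 0 < Ψ xbar := by
    have : 0 < Ψ xbar / Φ xbar := (div_nonneg hs0 hr.le).trans_lt ha1
    exact (div_pos_iff_of_pos_right hΦxbar).1 this
  have hlam0 : 0 < lam := (div_pos hΦxbar hΨxbar).trans hlam.1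
  have hspos : 0 < s := by
    refine hs0.lt_of_ne fun h => ?_
    have := hlam.2
    rw [← h, div_zero] at this
    linarith
  have hα : 0 < r - lam * s := by
    have := (lt_div_iff₀ hspos).1 hlam.2
    linarith
  have hIxbar : Φ xbar - lam * Ψ xbar < 0 := by
    have := (div_lt_iff₀ hΨxbar).1 hlam.1
    linarith
  have hI0 : Φ 0 - lam * Ψ 0 = 0 := by simp [hΦ0, hΨ0]
  have hlevel : ∀ x, Φ x = r → r - lam * s ≤ Φ x - lam * Ψ x := by
    intro x hx
    have := mul_le_mul_of_nonneg_left (hsle x hx.le) hlam0.le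
    linarith
  have hPS : PalaisSmale (fun x => Φ x - lam * Ψ x) (fun x => Φ' x - lam • Ψ' x) := by
    refine palaisSmale_of_leftInverse hTcont hTleft ?_
    rintro x ⟨M, hM⟩
    obtain ⟨R', hR'⟩ := hcoer (M + 1)
    refine ⟨_, (hΨ'compact (Metric.closedBall 0 R') Metric.isBounded_closedBall).image
      (continuous_const_smul lam), fun n => ⟨_, subset_closure ⟨x n, ?_, rfl⟩, rfl⟩⟩
    rw [mem_closedBall_zero_iff]
    by_contra! h
    linarith [hR' (x n) h.le, (abs_le.1 (hM n)).2]
  obtain ⟨m, hm⟩ := hΦ.exists_lower_bound hΦcoercive hTcont hTleft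
  obtain ⟨R', hR'⟩ := hcoer 0
  obtain ⟨C', hC'⟩ := hΨbdd R'
  have hbelow : ∀ x, min 0 (m - lam * C') ≤ Φ x - lam * Ψ x := by
    intro x
    rcases le_total R' ‖x‖ with h | h
    · exact (min_le_left _ _).trans (hR' x h)
    · have := mul_le_mul_of_nonneg_left (abs_le.1 (hC' x h)).2 hlam0.le
      exact (min_le_right _ _).trans (by linarith [hm x])
  have hc := hΦ.continuous
  obtain ⟨u, hur, hu, hule⟩ := hI.exists_critical_of_lt hPS (D := {x | Φ x ≤ r})
    (U := {x | Φ x < r}) (isClosed_le hc continuous_const) (isOpen_lt hc continuous_const)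
    (fun x (hx : Φ x < r) => hx.le) (fun x _ => hbelow x)
    (fun x hx hx' => hlevel x (le_antisymm hx (not_lt.1 hx'))) (x₀ := 0)
    (show Φ 0 ≤ r by rw [hΦ0]; exact hr.le) (by rwa [hI0])
  obtain ⟨v, hvr, hv, hvle⟩ := hI.exists_critical_of_lt hPS (D := {x | r ≤ Φ x})
    (U := {x | r < Φ x}) (isClosed_le continuous_const hc) (isOpen_lt continuous_const hc)
    (fun x (hx : r < Φ x) => hx.le) (fun x _ => hbelow x)
    (fun x hx hx' => hlevel x (le_antisymm (not_lt.1 hx') hx)) (x₀ := xbar)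
    hrx.le (hIxbar.trans hα)
  have hur : Φ u < r := hur
  have hvr : r < Φ v := hvr
  have hulow : Φ u - lam * Ψ u < r - lam * s := by linarith
  have hvlow : Φ v - lam * Ψ v < r - lam * s := by linarith
  obtain ⟨w, hw, hwle⟩ := hI.mountain_pass hPS hc hlevel hur.le hvr.le hulow hvlow
  refine ⟨u, v, w, ?_, ?_, ?_, sub_eq_zero.1 hu, sub_eq_zero.1 hv, sub_eq_zero.1 hw⟩
  · rintro rfl
    exact hur.not_gt hvr
  · rintro rfl
    exact hwle.not_gt hulow
  · rintro rfl
    exact hwle.not_gt hvlow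
end

section
/- Let X be a reflexive real Banach space and A : X → X* an operator that is: (i) monotone, i.e., (A u − A v)(u − v) ≥ 0 for all u, v ∈ X; (ii) coercive, i.e., (A u)(u)/‖u‖ → +∞ as ‖u‖ → +∞; and (iii) hemicontinuous, i.e., for all u, v, w ∈ X the real function t ↦ (A(u + t v))(w) is continuous on ℝ. Then A is surjective: for every ℓ ∈ X* there exists u ∈ X with A u = ℓ. -/
open Set Filter Topology

/-- A skew game has nonnegative value: if `M + Mᵀ` is entrywise nonnegative, then some mixed
strategy of the column player makes every row payoff nonnegative. -/
theorem exists_mem_stdSimplex_sum_nonneg {ι : Type*} [Fintype ι] [Nonempty ι] (M : ι → ι → ℝ)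
    (hM : ∀ i j, 0 ≤ M i j + M j i) :
    ∃ b ∈ stdSimplex ℝ ι, ∀ i, 0 ≤ ∑ j, b j * M i j := by
  classical
  let L : (ι → ℝ) →ₗ[ℝ] (ι → ℝ) →ₗ[ℝ] ℝ := Matrix.toLinearMap₂' ℝ (Matrix.of M)
  have hL (x y : ι → ℝ) : L x y = ∑ i, ∑ j, x i * (y j * M i j) := by
    simp [L, Matrix.toLinearMap₂'_apply]
  have hne : (stdSimplex ℝ ι).Nonempty := ⟨_, single_mem_stdSimplex ℝ (Classical.arbitrary ι)⟩
  have hconv := convex_stdSimplex ℝ ι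
  have hcomp := isCompact_stdSimplex ℝ ι
  obtain ⟨a, ha, b, hb, hab⟩ := Sion.exists_isSaddlePointOn (f := fun x y ↦ L x y)
    hne hconv hcomp
    (fun y _ ↦ (L.flip y).continuous_of_finiteDimensional.lowerSemicontinuous.lowerSemicontinuousOn
      _)
    (fun y _ ↦ ((L.flip y).convexOn hconv).quasiconvexOn) hconv hne hcomp
    (fun x _ ↦ (L x).continuous_of_finiteDimensional.upperSemicontinuous.upperSemicontinuousOn _)
    (fun x _ ↦ ((L x).concaveOn hconv).quasiconcaveOn)
  have haa : 0 ≤ L a a := by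
    have hsymm : L a a + L a a = ∑ i, ∑ j, a i * a j * (M i j + M j i) := by
      conv_lhs => rw [hL]; arg 2; rw [Finset.sum_comm]
      simp_rw [← Finset.sum_add_distrib]
      exact Finset.sum_congr rfl fun i _ ↦ Finset.sum_congr rfl fun j _ ↦ by ring
    have : 0 ≤ L a a + L a a := hsymm ▸ Finset.sum_nonneg fun i _ ↦ Finset.sum_nonneg fun j _ ↦
      mul_nonneg (mul_nonneg (ha.1 i) (ha.1 j)) (hM i j)
    linarith
  refine ⟨b, hb, fun i ↦ ?_⟩
  have h : 0 ≤ L (Pi.single i 1) b := haa.trans (hab _ (single_mem_stdSimplex ℝ i) _ ha)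
  rw [hL, Finset.sum_eq_single i (fun k _ hk ↦ by simp [hk]) (by simp)] at h
  simpa using h

section MonotoneOperator

variable {X : Type*} [NormedAddCommGroup X] [NormedSpace ℝ X] {A : X → (X →L[ℝ] ℝ)}

theorem exists_mem_convexHull_forall_nonneg_of_monotone
    (hmono : ∀ u v : X, 0 ≤ (A u - A v) (u - v)) {s : Finset X} (hs : s.Nonempty) :
    ∃ x ∈ convexHull ℝ (s : Set X), ∀ v ∈ s, 0 ≤ A v (v - x) := by
  have : Nonempty s := hs.to_subtype
  obtain ⟨b, ⟨hb0, hb1⟩, hb⟩ := exists_mem_stdSimplex_sum_nonneg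
    (fun i j : s ↦ A i (i - j : X)) fun i j ↦ by
      have := hmono i j
      simp only [sub_apply, map_sub] at this ⊢
      linarith
  refine ⟨∑ j, b j • (j : X), (convex_convexHull ℝ _).sum_mem (fun j _ ↦ hb0 j) hb1
    fun j _ ↦ subset_convexHull ℝ _ j.2, fun v hv ↦ ?_⟩
  convert hb ⟨v, hv⟩ using 1
  simp_rw [map_sub, mul_sub, Finset.sum_sub_distrib, ← Finset.sum_mul, hb1, one_mul, map_sum,
    map_smul, smul_eq_mul]

/-- A monotone operator on a ball of a reflexive space admits a solution of Minty's
variational inequality. -/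
theorem exists_mem_closedBall_forall_nonneg_of_monotone
    (hrefl : Function.Surjective (NormedSpace.inclusionInDoubleDual ℝ X))
    (hmono : ∀ u v : X, 0 ≤ (A u - A v) (u - v)) {R : ℝ} (hR : 0 ≤ R) :
    ∃ x ∈ Metric.closedBall (0 : X) R, ∀ v ∈ Metric.closedBall (0 : X) R, 0 ≤ A v (v - x) := by
  classical
  let J : X → WeakDual ℝ (StrongDual ℝ X) := fun x ↦
    StrongDual.toWeakDual (NormedSpace.inclusionInDoubleDual ℝ X x)
  have hJball (x : X) :
      J x ∈ WeakDual.toStrongDual ⁻¹' Metric.closedBall (0 : StrongDual ℝ (StrongDual ℝ X)) R ↔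
        x ∈ Metric.closedBall (0 : X) R := by
    have h := mem_closedBall_zero_iff (a := NormedSpace.inclusionInDoubleDualLi ℝ x) (r := R)
    rw [LinearIsometry.norm_map] at h
    exact h.trans mem_closedBall_zero_iff.symm
  have hcompact := WeakDual.isCompact_closedBall (𝕜 := ℝ) (0 : StrongDual ℝ (StrongDual ℝ X)) R
  obtain ⟨φ, hφR, hφ⟩ := hcompact.inter_iInter_nonempty
    (fun v : Metric.closedBall (0 : X) R ↦ {φ | φ (A v) ≤ A v v})
    (fun v ↦ isClosed_le (WeakDual.eval_continuous _) continuous_const) fun s ↦ by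
      obtain ⟨x, hx, hxs⟩ := exists_mem_convexHull_forall_nonneg_of_monotone hmono
        (Finset.insert_nonempty 0 (s.image Subtype.val))
      refine ⟨J x, (hJball x).2 (convexHull_min ?_ (convex_closedBall 0 R) hx),
        mem_iInter₂.2 fun v hv ↦ ?_⟩
      · intro y hy
        simp only [Finset.coe_insert, Finset.coe_image, mem_insert_iff, mem_image] at hy
        obtain rfl | ⟨v, -, rfl⟩ := hy
        · simpa using hR
        · exact v.2
      · have := hxs v (Finset.mem_insert_of_mem (Finset.mem_image_of_mem _ hv))
        rw [map_sub, sub_nonneg] at this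
        exact this
  obtain ⟨x, hx⟩ := hrefl (WeakDual.toStrongDual φ)
  obtain rfl : J x = φ := WeakDual.toStrongDual.injective hx
  refine ⟨x, (hJball x).1 hφR, fun v hv ↦ ?_⟩
  rw [map_sub, sub_nonneg]
  exact mem_iInter.1 hφ ⟨v, hv⟩

/-- **Minty's lemma**: for a hemicontinuous operator, Minty's variational inequality on a convex
set implies Stampacchia's. -/
theorem Convex.nonneg_of_forall_nonneg_of_hemicontinuous {K : Set X} (hK : Convex ℝ K)
    (hhemi : ∀ u v w : X, Continuous fun t : ℝ => (A (u + t • v)) w) {x : X} (hx : x ∈ K)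
    (hmin : ∀ v ∈ K, 0 ≤ A v (v - x)) {v : X} (hv : v ∈ K) : 0 ≤ A x (v - x) := by
  have hlim : Tendsto (fun t : ℝ ↦ A (x + t • (v - x)) (v - x)) (𝓝[>] 0) (𝓝 (A x (v - x))) := by
    simpa using ((hhemi x (v - x) (v - x)).tendsto 0).mono_left nhdsWithin_le_nhds
  refine ge_of_tendsto hlim ?_
  filter_upwards [Ioc_mem_nhdsGT (zero_lt_one' ℝ)] with t ht
  have := hmin _ (hK.add_smul_sub_mem hx hv ⟨ht.1.le, ht.2⟩)
  rw [add_sub_cancel_left, map_smul, smul_eq_mul] at this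
  exact nonneg_of_mul_nonneg_right this ht.1

theorem exists_eq_zero_of_monotone_of_hemicontinuous
    (hrefl : Function.Surjective (NormedSpace.inclusionInDoubleDual ℝ X))
    (hmono : ∀ u v : X, 0 ≤ (A u - A v) (u - v))
    (hhemi : ∀ u v w : X, Continuous fun t : ℝ => (A (u + t • v)) w)
    {r : ℝ} (hpos : ∀ u : X, r ≤ ‖u‖ → 0 < A u u) : ∃ u, A u = 0 := by
  have hR : 0 ≤ max r 0 + 1 := by positivity
  obtain ⟨x, hx, hmin⟩ := exists_mem_closedBall_forall_nonneg_of_monotone hrefl hmono hR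
  have hvar {v : X} (hv : v ∈ Metric.closedBall (0 : X) (max r 0 + 1)) : 0 ≤ A x (v - x) :=
    (convex_closedBall 0 _).nonneg_of_forall_nonneg_of_hemicontinuous hhemi hx hmin hv
  have hxr : ‖x‖ < r := by
    by_contra! h
    have h₀ := hvar (Metric.mem_closedBall_self hR)
    rw [zero_sub, map_neg] at h₀
    linarith [hpos x h]
  have hnonneg (w : X) : 0 ≤ A x w := by
    have hball : Metric.closedBall (0 : X) (max r 0 + 1) ∈ 𝓝 (x + (0 : ℝ) • w) := by
      refine mem_of_superset (Metric.isOpen_ball.mem_nhds ?_) Metric.ball_subset_closedBall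
      rw [zero_smul, add_zero, mem_ball_zero_iff]
      linarith [le_max_left r 0]
    have hcont : Continuous fun t : ℝ ↦ x + t • w := by fun_prop
    obtain ⟨t, ht, ht₀⟩ := ((((hcont.tendsto 0).mono_left nhdsWithin_le_nhds).eventually
      hball).and (self_mem_nhdsWithin (s := Ioi (0 : ℝ)))).exists
    have := hvar ht
    rw [add_sub_cancel_left, map_smul, smul_eq_mul] at this
    exact nonneg_of_mul_nonneg_right this ht₀
  refine ⟨x, ContinuousLinearMap.ext fun w ↦ le_antisymm ?_ (hnonneg w)⟩
  simpa using hnonneg (-w)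

end MonotoneOperator

/-- Minty–Browder theorem (Zeidler, Theorem 26.A): a monotone, coercive,
hemicontinuous operator from a reflexive real Banach space to its dual is surjective. -/
theorem minty_browder_surjective
    (X : Type*) [NormedAddCommGroup X] [NormedSpace ℝ X] [CompleteSpace X]
    -- X is reflexive: the canonical inclusion into the double dual is surjective
    (hrefl : Function.Surjective (NormedSpace.inclusionInDoubleDual ℝ X))
    (A : X → (X →L[ℝ] ℝ))
    -- monotone
    (hmono : ∀ u v : X, 0 ≤ (A u - A v) (u - v))
    -- coercive
    (hcoer : ∀ M : ℝ, ∃ R : ℝ, ∀ u : X, R ≤ ‖u‖ → M ≤ (A u) u / ‖u‖)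
    -- hemicontinuous
    (hhemi : ∀ u v w : X, Continuous fun t : ℝ => (A (u + t • v)) w) :
    Function.Surjective A := by
  intro ℓ
  obtain ⟨R, hR⟩ := hcoer (‖ℓ‖ + 1)
  obtain ⟨u, hu⟩ := exists_eq_zero_of_monotone_of_hemicontinuous (A := fun u ↦ A u - ℓ)
    (r := max R 1) hrefl (fun u v ↦ by simpa using hmono u v)
    (fun u v w ↦ (hhemi u v w).sub continuous_const) fun u hu ↦ by
      have hu₀ : 0 < ‖u‖ := zero_lt_one.trans_le ((le_max_right R 1).trans hu)
      have h := (le_div_iff₀ hu₀).1 (hR u ((le_max_left R 1).trans hu))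
      have hℓ := (le_abs_self _).trans (ℓ.le_opNorm u)
      rw [sub_apply]
      linarith
  exact ⟨u, sub_eq_zero.1 hu⟩
end

section
/- Let N ≥ 1 be an integer, p ≥ 2 a real number, and a : [0, +∞) → [0, +∞) a function of class C¹ for which there exists c > 0 such that min{ a(τ^p) τ^{p−2} , a(τ^p) τ^{p−2} + τ · (d/dτ)(a(τ^p) τ^{p−2}) } ≥ c τ^{p−2} for all τ > 0. Then there exists a constant C_p > 0 such that for all ϱ, ζ ∈ ℝ^N: ( a(|ϱ|^p) |ϱ|^{p−2} ϱ − a(|ζ|^p) |ζ|^{p−2} ζ ) · (ϱ − ζ) ≥ C_p |ϱ − ζ|^p, where · is the standard inner product on ℝ^N and |·| the Euclidean norm (with the convention that |ϱ|^{p−2}ϱ = 0 when ϱ = 0). -/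
open scoped RealInnerProductSpace

section

variable {E : Type*} [NormedAddCommGroup E] [InnerProductSpace ℝ E]

/-- A radial vector field `x ↦ f ‖x‖ • x` is monotone when `f ≥ 0` and `t ↦ t * f t` is monotone
on the positive half-line. -/
theorem inner_radial_sub_nonneg {f : ℝ → ℝ} (hf : ∀ t, 0 < t → 0 ≤ f t)
    (hmono : MonotoneOn (fun t => t * f t) (Set.Ioi 0)) (x y : E) :
    0 ≤ ⟪f ‖x‖ • x - f ‖y‖ • y, x - y⟫ := by
  rcases eq_or_ne x 0 with rfl | hx
  · rcases eq_or_ne y 0 with rfl | hy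
    · simp
    · simpa [inner_smul_left] using mul_nonneg (hf _ (norm_pos_iff.2 hy)) (sq_nonneg ‖y‖)
  rcases eq_or_ne y 0 with rfl | hy
  · simpa [inner_smul_left] using mul_nonneg (hf _ (norm_pos_iff.2 hx)) (sq_nonneg ‖x‖)
  have hx' := norm_pos_iff.2 hx
  have hy' := norm_pos_iff.2 hy
  have hdiag : 0 ≤ (‖x‖ * f ‖x‖ - ‖y‖ * f ‖y‖) * (‖x‖ - ‖y‖) := by
    rcases le_total ‖x‖ ‖y‖ with h | h
    · exact mul_nonneg_of_nonpos_of_nonpos (sub_nonpos.2 (hmono hx' hy' h)) (sub_nonpos.2 h)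
    · exact mul_nonneg (sub_nonneg.2 (hmono hy' hx' h)) (sub_nonneg.2 h)
  have hcross : 0 ≤ (f ‖x‖ + f ‖y‖) * (‖x‖ * ‖y‖ - ⟪x, y⟫) :=
    mul_nonneg (add_nonneg (hf _ hx') (hf _ hy')) (sub_nonneg.2 (real_inner_le_norm x y))
  simp only [inner_sub_left, inner_sub_right, real_inner_smul_left, real_inner_self_eq_norm_sq,
    real_inner_comm x y]
  linarith

/-- Strong monotonicity of the `p`-Laplacian vector field for `p ≥ 2`. -/
theorem norm_sub_rpow_le_inner_pLaplacian {p : ℝ} (hp : 2 ≤ p) (x y : E) :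
    ‖x - y‖ ^ p ≤
      2 * 2 ^ (p - 2) * ⟪‖x‖ ^ (p - 2) • x - ‖y‖ ^ (p - 2) • y, x - y⟫ := by
  have hq : 0 ≤ p - 2 := sub_nonneg.2 hp
  have hx := norm_nonneg x
  have hy := norm_nonneg y
  have hx' := Real.rpow_nonneg hx (p - 2)
  have hy' := Real.rpow_nonneg hy (p - 2)
  have hdist : ‖x - y‖ ^ (p - 2) ≤ 2 ^ (p - 2) * (‖x‖ ^ (p - 2) + ‖y‖ ^ (p - 2)) := by
    have hmax : ‖x - y‖ ≤ 2 * max ‖x‖ ‖y‖ := by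
      linarith [norm_sub_le x y, le_max_left ‖x‖ ‖y‖, le_max_right ‖x‖ ‖y‖]
    refine (Real.rpow_le_rpow (norm_nonneg _) hmax hq).trans ?_
    rw [Real.mul_rpow zero_le_two (le_max_of_le_left hx)]
    gcongr
    rcases max_choice ‖x‖ ‖y‖ with h | h <;> rw [h] <;> linarith
  have hdiag : 0 ≤ (‖x‖ ^ (p - 2) - ‖y‖ ^ (p - 2)) * (‖x‖ ^ 2 - ‖y‖ ^ 2) := by
    rcases le_total ‖x‖ ‖y‖ with h | h
    · exact mul_nonneg_of_nonpos_of_nonpos (sub_nonpos.2 (Real.rpow_le_rpow hx h hq))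
        (sub_nonpos.2 (pow_le_pow_left₀ hx h 2))
    · exact mul_nonneg (sub_nonneg.2 (Real.rpow_le_rpow hy h hq))
        (sub_nonneg.2 (pow_le_pow_left₀ hy h 2))
  have hinner : (‖x‖ ^ (p - 2) + ‖y‖ ^ (p - 2)) * ‖x - y‖ ^ 2 ≤
      2 * ⟪‖x‖ ^ (p - 2) • x - ‖y‖ ^ (p - 2) • y, x - y⟫ := by
    rw [norm_sub_sq_real]
    simp only [inner_sub_left, inner_sub_right, real_inner_smul_left, real_inner_self_eq_norm_sq,
      real_inner_comm x y]
    linarith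
  calc ‖x - y‖ ^ p = ‖x - y‖ ^ (p - 2) * ‖x - y‖ ^ 2 := by
        rw [← Real.rpow_natCast, ← Real.rpow_add_of_nonneg (norm_nonneg _) hq (by simp)]
        norm_num
    _ ≤ 2 ^ (p - 2) * (‖x‖ ^ (p - 2) + ‖y‖ ^ (p - 2)) * ‖x - y‖ ^ 2 := by gcongr
    _ = 2 ^ (p - 2) * ((‖x‖ ^ (p - 2) + ‖y‖ ^ (p - 2)) * ‖x - y‖ ^ 2) := by ring
    _ ≤ 2 ^ (p - 2) * (2 * ⟪‖x‖ ^ (p - 2) • x - ‖y‖ ^ (p - 2) • y, x - y⟫) := by gcongr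
    _ = _ := by ring

end

/-- If `g + t g' ≥ k (p - 1) t ^ (p - 2)` on the positive half-line, then
`t ↦ t * (g t - k * t ^ (p - 2))` is monotone there. -/
theorem monotoneOn_mul_sub_rpow {g g' : ℝ → ℝ} {p k : ℝ}
    (hg : ∀ t, 0 < t → HasDerivAt g (g' t) t)
    (hell : ∀ t, 0 < t → k * (p - 1) * t ^ (p - 2) ≤ g t + t * g' t) :
    MonotoneOn (fun t => t * (g t - k * t ^ (p - 2))) (Set.Ioi 0) := by
  have hderiv : ∀ t : ℝ, 0 < t → HasDerivAt (fun t => t * (g t - k * t ^ (p - 2)))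
      (g t + t * g' t - k * (p - 1) * t ^ (p - 2)) t := by
    intro t ht
    have h := (hasDerivAt_id' t).mul
      ((hg t ht).sub ((Real.hasDerivAt_rpow_const (p := p - 2) (Or.inl ht.ne')).const_mul k))
    refine h.congr_deriv ?_
    have hpow : t ^ (p - 2) = t ^ (p - 2 - 1) * t := by
      rw [Real.rpow_sub_one ht.ne', div_mul_cancel₀ _ ht.ne']
    simp only [Pi.sub_apply, hpow]
    ring
  refine monotoneOn_of_deriv_nonneg (convex_Ioi 0)
    (fun t ht => (hderiv t ht).continuousAt.continuousWithinAt)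
    (fun t ht => (hderiv t (interior_subset ht)).differentiableAt.differentiableWithinAt)
    fun t ht => ?_
  rw [(hderiv t (interior_subset ht)).deriv]
  exact sub_nonneg.2 (hell t (interior_subset ht))

/-- Elementary monotonicity inequality for the generalized `p`-Laplacian vector
field, case `p ≥ 2`. -/
theorem generalized_pLaplacian_monotonicity_p_ge_two
    (N : ℕ) (hN : 1 ≤ N) (p : ℝ) (hp : 2 ≤ p)
    (a : ℝ → ℝ) (ha_nn : ∀ t : ℝ, 0 ≤ t → 0 ≤ a t)
    (haC1 : ContDiffOn ℝ 1 a (Set.Ici 0))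
    (g' : ℝ → ℝ)
    (hg' : ∀ τ : ℝ, 0 < τ → HasDerivAt (fun t : ℝ => a (t ^ p) * t ^ (p - 2)) (g' τ) τ)
    (c : ℝ) (hc : 0 < c)
    (hell : ∀ τ : ℝ, 0 < τ →
      c * τ ^ (p - 2) ≤ min (a (τ ^ p) * τ ^ (p - 2))
        (a (τ ^ p) * τ ^ (p - 2) + τ * g' τ)) :
    ∃ Cp : ℝ, 0 < Cp ∧ ∀ ϱ ζ : EuclideanSpace ℝ (Fin N),
      Cp * ‖ϱ - ζ‖ ^ p ≤
        ⟪(a (‖ϱ‖ ^ p) * ‖ϱ‖ ^ (p - 2)) • ϱ - (a (‖ζ‖ ^ p) * ‖ζ‖ ^ (p - 2)) • ζ,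
          ϱ - ζ⟫ := by
  have hp1 : 0 < p - 1 := by linarith
  set k := c / (p - 1) with hk
  have hk0 : 0 < k := div_pos hc hp1
  have hkc : k ≤ c := div_le_self hc.le (by linarith)
  have hB : (0 : ℝ) < 2 * 2 ^ (p - 2) := by positivity
  refine ⟨k / (2 * 2 ^ (p - 2)), by positivity, fun ϱ ζ => ?_⟩
  have hradial := inner_radial_sub_nonneg
    (f := fun t => a (t ^ p) * t ^ (p - 2) - k * t ^ (p - 2))
    (fun t ht => sub_nonneg.2 <| (mul_le_mul_of_nonneg_right hkc (Real.rpow_nonneg ht.le _)).trans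
      ((hell t ht).trans (min_le_left _ _)))
    (monotoneOn_mul_sub_rpow hg' fun t ht => by
      rw [hk, div_mul_cancel₀ _ hp1.ne']
      exact (hell t ht).trans (min_le_right _ _)) ϱ ζ
  have hpLap := norm_sub_rpow_le_inner_pLaplacian hp ϱ ζ
  calc k / (2 * 2 ^ (p - 2)) * ‖ϱ - ζ‖ ^ p
      ≤ k / (2 * 2 ^ (p - 2)) * (2 * 2 ^ (p - 2) *
          ⟪‖ϱ‖ ^ (p - 2) • ϱ - ‖ζ‖ ^ (p - 2) • ζ, ϱ - ζ⟫) := by gcongr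
    _ = k * ⟪‖ϱ‖ ^ (p - 2) • ϱ - ‖ζ‖ ^ (p - 2) • ζ, ϱ - ζ⟫ := by
        rw [← mul_assoc, div_mul_cancel₀ _ hB.ne']
    _ ≤ _ := by
        simp only [inner_sub_left, real_inner_smul_left] at hradial ⊢
        linarith
end

section
/- Let N ≥ 1 be an integer, 1 < p < 2 a real number, and a : [0, +∞) → [0, +∞) a function of class C¹ for which there exists c > 0 such that min{ a(τ^p) τ^{p−2} , a(τ^p) τ^{p−2} + τ · (d/dτ)(a(τ^p) τ^{p−2}) } ≥ c τ^{p−2} for all τ > 0. Then there exists a constant C_p > 0 such that for all ϱ, ζ ∈ ℝ^N with (ϱ, ζ) ≠ (0, 0): ( a(|ϱ|^p) |ϱ|^{p−2} ϱ − a(|ζ|^p) |ζ|^{p−2} ζ ) · (ϱ − ζ) ≥ C_p |ϱ − ζ|² / (|ϱ| + |ζ|)^{2−p}, where · is the standard inner product on ℝ^N and |·| the Euclidean norm (with the convention that |ϱ|^{p−2}ϱ = 0 when ϱ = 0). -/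
open scoped RealInnerProductSpace

/-- A radial vector field `x ↦ G ‖x‖ • x` is strongly monotone between `x` and `y` with modulus `M`
as soon as `G ≥ M` at both norms and `t ↦ t * G t` grows at rate at least `M` between them. -/
theorem mul_norm_sub_sq_le_inner_smul_sub_smul {E : Type*} [NormedAddCommGroup E]
    [InnerProductSpace ℝ E] {G : ℝ → ℝ} {M : ℝ} {x y : E} (hx : M ≤ G ‖x‖) (hy : M ≤ G ‖y‖)
    (h : M * (‖x‖ - ‖y‖) ^ 2 ≤ (‖x‖ * G ‖x‖ - ‖y‖ * G ‖y‖) * (‖x‖ - ‖y‖)) :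
    M * ‖x - y‖ ^ 2 ≤ ⟪G ‖x‖ • x - G ‖y‖ • y, x - y⟫ := by
  have hinner : ⟪G ‖x‖ • x - G ‖y‖ • y, x - y⟫ =
      G ‖x‖ * ‖x‖ ^ 2 + G ‖y‖ * ‖y‖ ^ 2 - (G ‖x‖ + G ‖y‖) * ⟪x, y⟫ := by
    simp only [inner_sub_left, inner_sub_right, real_inner_smul_left,
      real_inner_self_eq_norm_sq, real_inner_comm x y]
    ring
  rw [hinner, norm_sub_sq_real]
  have hcs := real_inner_le_norm x y
  nlinarith [mul_nonneg (sub_nonneg.2 hx) (sub_nonneg.2 hcs),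
    mul_nonneg (sub_nonneg.2 hy) (sub_nonneg.2 hcs)]

/-- If `t * G t` has derivative at least `c * t ^ q` with `q ≤ 0`, then it grows at rate at least
`c * (r + s) ^ q` between `s` and `r`. -/
theorem rpow_mul_sub_sq_le_of_le_deriv {G G' : ℝ → ℝ} {c q : ℝ} (hc : 0 ≤ c) (hq : q ≤ 0)
    (hG : ∀ t, 0 < t → HasDerivAt G (G' t) t)
    (hG' : ∀ t, 0 < t → c * t ^ q ≤ G t + t * G' t) {r s : ℝ} (hr : 0 < r) (hs : 0 < s) :
    c * (r + s) ^ q * (r - s) ^ 2 ≤ (r * G r - s * G s) * (r - s) := by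
  wlog hsr : s ≤ r generalizing r s
  · have := this hs hr (le_of_not_ge hsr)
    rw [add_comm s r] at this
    linarith
  have hd : ∀ t, 0 < t → HasDerivAt (fun t => t * G t) (G t + t * G' t) t := fun t ht => by
    simpa only [one_mul] using (hasDerivAt_id' t).fun_mul (hG t ht)
  have hpos : ∀ t ∈ Set.Icc s r, 0 < t := fun t ht => hs.trans_le ht.1
  have hmvt := (convex_Icc s r).mul_sub_le_image_sub_of_le_deriv
    (f := fun t => t * G t) (C := c * (r + s) ^ q)
    (fun t ht => (hd t (hpos t ht)).continuousAt.continuousWithinAt)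
    (fun t ht => (hd t (hpos t (interior_subset ht))).differentiableAt.differentiableWithinAt)
    (fun t ht => by
      have ht' := interior_subset ht
      have ht0 := hpos t ht'
      rw [(hd t ht0).deriv]
      refine le_trans ?_ (hG' t ht0)
      exact mul_le_mul_of_nonneg_left
        (Real.rpow_le_rpow_of_nonpos ht0 (by linarith [ht'.2]) hq) hc)
    s ⟨le_rfl, hsr⟩ r ⟨hsr, le_rfl⟩ hsr
  nlinarith [mul_le_mul_of_nonneg_right hmvt (sub_nonneg.2 hsr)]

/-- Elementary monotonicity inequality for the generalized `p`-Laplacian vector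
field, singular case `1 < p < 2`. -/
theorem generalized_pLaplacian_monotonicity_p_lt_two
    (N : ℕ) (hN : 1 ≤ N) (p : ℝ) (hp1 : 1 < p) (hp2 : p < 2)
    (a : ℝ → ℝ) (ha_nn : ∀ t : ℝ, 0 ≤ t → 0 ≤ a t)
    (haC1 : ContDiffOn ℝ 1 a (Set.Ici 0))
    (g' : ℝ → ℝ)
    (hg' : ∀ τ : ℝ, 0 < τ → HasDerivAt (fun t : ℝ => a (t ^ p) * t ^ (p - 2)) (g' τ) τ)
    (c : ℝ) (hc : 0 < c)
    (hell : ∀ τ : ℝ, 0 < τ →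
      c * τ ^ (p - 2) ≤ min (a (τ ^ p) * τ ^ (p - 2))
        (a (τ ^ p) * τ ^ (p - 2) + τ * g' τ)) :
    ∃ Cp : ℝ, 0 < Cp ∧ ∀ ϱ ζ : EuclideanSpace ℝ (Fin N), ¬(ϱ = 0 ∧ ζ = 0) →
      Cp * ‖ϱ - ζ‖ ^ (2:ℝ) / (‖ϱ‖ + ‖ζ‖) ^ (2 - p) ≤
        ⟪(a (‖ϱ‖ ^ p) * ‖ϱ‖ ^ (p - 2)) • ϱ - (a (‖ζ‖ ^ p) * ‖ζ‖ ^ (p - 2)) • ζ,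
          ϱ - ζ⟫ := by
  let G : ℝ → ℝ := fun t => a (t ^ p) * t ^ (p - 2)
  have hG1 : ∀ t, 0 < t → c * t ^ (p - 2) ≤ G t := fun t ht => (hell t ht).trans (min_le_left _ _)
  have hG2 : ∀ t, 0 < t → c * t ^ (p - 2) ≤ G t + t * g' t :=
    fun t ht => (hell t ht).trans (min_le_right _ _)
  refine ⟨c, hc, fun x y hxy => ?_⟩
  have hsq : c * ‖x - y‖ ^ (2 : ℝ) / (‖x‖ + ‖y‖) ^ (2 - p) =
      c * (‖x‖ + ‖y‖) ^ (p - 2) * ‖x - y‖ ^ 2 := by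
    rw [← neg_sub 2 p, Real.rpow_neg (by positivity), Real.rpow_two]
    ring
  rw [hsq]
  change _ ≤ ⟪G ‖x‖ • x - G ‖y‖ • y, x - y⟫
  rcases eq_or_ne x 0 with rfl | hx
  · have hy : y ≠ 0 := fun h => hxy ⟨rfl, h⟩
    simpa [inner_smul_left, real_inner_self_eq_norm_sq] using
      mul_le_mul_of_nonneg_right (hG1 ‖y‖ (norm_pos_iff.2 hy)) (sq_nonneg ‖y‖)
  rcases eq_or_ne y 0 with rfl | hy
  · simpa [inner_smul_left, real_inner_self_eq_norm_sq] using
      mul_le_mul_of_nonneg_right (hG1 ‖x‖ (norm_pos_iff.2 hx)) (sq_nonneg ‖x‖)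
  have hx0 := norm_pos_iff.2 hx
  have hy0 := norm_pos_iff.2 hy
  have hM : ∀ t, 0 < t → t ≤ ‖x‖ + ‖y‖ → c * (‖x‖ + ‖y‖) ^ (p - 2) ≤ G t := fun t ht hle =>
    (mul_le_mul_of_nonneg_left
      (Real.rpow_le_rpow_of_nonpos ht hle (by linarith)) hc.le).trans (hG1 t ht)
  exact mul_norm_sub_sq_le_inner_smul_sub_smul (hM _ hx0 (by linarith)) (hM _ hy0 (by linarith))
    (rpow_mul_sub_sq_le_of_le_deriv hc.le (by linarith) hg' hG2 hx0 hy0)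
end
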